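/- Let ρ : ℝ^d → [1,∞) be a function that is nondecreasing with respect to |x| (i.e., ρ(x) ≤ ρ(y) whenever |x| ≤ |y|). Then sup_{x∈ℝ^d} ( Pρ(x) / ρ(x) ) ≤ sup { ρ(y)/ρ(x) : x ∈ □, y ∈ □, |y − x| ≤ √d · δ }. -/

import Mathlib

open MeasureTheory Finset
open scoped Classical

noncomputable section

/-- the hat basis function `ψ_z(x) = ∏ᵢ (1 − |xᵢ − zᵢ|/δ)₊`. -/
def hatFn {d : ℕ} (δ : ℝ) (z x : EuclideanSpace ℝ (Fin d)) : ℝ :=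
  ∏ i, max 0 (1 - |x i - z i| / δ)

/-- multilinear interpolation on the grid `G`, using the projection `proj` onto the convex
hull of `G` for points outside the hull. -/
def interp {d : ℕ} (δ : ℝ) (G : Finset (EuclideanSpace ℝ (Fin d)))
    (proj : EuclideanSpace ℝ (Fin d) → EuclideanSpace ℝ (Fin d))
    {V : Type*} [AddCommMonoid V] [Module ℝ V]
    (φ : EuclideanSpace ℝ (Fin d) → V) (x : EuclideanSpace ℝ (Fin d)) : V :=
  if x ∈ convexHull ℝ (G : Set (EuclideanSpace ℝ (Fin d))) then
    ∑ z ∈ G, hatFn δ z x • φ z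
  else
    ∑ z ∈ G, hatFn δ z (proj x) • φ z

end


/-- The integer translates of the one-dimensional hat function sum to at most one. -/
lemma sum_hat_int_le_one (S : Finset ℤ) (u : ℝ) :
    ∑ k ∈ S, max 0 (1 - |u - (k : ℝ)|) ≤ 1 := by
  have hzero : ∀ k ∈ S, k ∉ ({⌊u⌋, ⌊u⌋ + 1} : Finset ℤ) → max 0 (1 - |u - (k : ℝ)|) = 0 := by
    intro k _ hk
    simp only [Finset.mem_insert, Finset.mem_singleton, not_or] at hk
    apply max_eq_left
    rcases lt_or_ge k ⌊u⌋ with h | h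
    · have h1 : (k : ℝ) + 1 ≤ ⌊u⌋ := by exact_mod_cast h
      linarith [le_abs_self (u - (k : ℝ)), Int.floor_le u]
    · have h1 : (⌊u⌋ : ℝ) + 2 ≤ k := by
        have : ⌊u⌋ + 2 ≤ k := by omega
        exact_mod_cast this
      linarith [neg_abs_le (u - (k : ℝ)), Int.lt_floor_add_one u]
  calc ∑ k ∈ S, max 0 (1 - |u - (k : ℝ)|)
      ≤ ∑ k ∈ S ∪ {⌊u⌋, ⌊u⌋ + 1}, max 0 (1 - |u - (k : ℝ)|) :=
        Finset.sum_le_sum_of_subset_of_nonneg Finset.subset_union_left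
          fun _ _ _ => le_max_left _ _
    _ = ∑ k ∈ ({⌊u⌋, ⌊u⌋ + 1} : Finset ℤ), max 0 (1 - |u - (k : ℝ)|) := by
        symm
        refine Finset.sum_subset Finset.subset_union_right fun k hk hk' => ?_
        exact hzero k ((Finset.mem_union.1 hk).resolve_right hk') hk'
    _ = 1 := by
        have h1 := Int.floor_le u
        have h2 := Int.lt_floor_add_one u
        rw [Finset.sum_pair (by omega)]
        push_cast
        rw [abs_of_nonneg (by linarith), abs_of_nonpos (by linarith),
          max_eq_right (by linarith), max_eq_right (by linarith)]
        ring

lemma hatFn_nonneg {d : ℕ} (δ : ℝ) (z x : EuclideanSpace ℝ (Fin d)) : 0 ≤ hatFn δ z x :=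
  Finset.prod_nonneg fun _ _ => le_max_left _ _

/-- Hat functions centred at finitely many distinct grid points sum to at most one. -/
lemma sum_hatFn_le_one {d : ℕ} {δ : ℝ} (hδ : 0 < δ)
    (G : Finset (EuclideanSpace ℝ (Fin d)))
    (hG : ∀ z ∈ G, ∀ i, ∃ k : ℤ, z i = (k : ℝ) * δ) (x : EuclideanSpace ℝ (Fin d)) :
    ∑ z ∈ G, hatFn δ z x ≤ 1 := by
  choose! k hk using hG
  have hinj : Set.InjOn k G := by
    intro z hz w hw h
    ext i
    rw [hk z hz i, hk w hw i, h]
  set f : Fin d → ℤ → ℝ := fun i n => max 0 (1 - |x i / δ - (n : ℝ)|) with hf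
  have hf0 : ∀ i n, 0 ≤ f i n := fun _ _ => le_max_left _ _
  calc ∑ z ∈ G, hatFn δ z x = ∑ z ∈ G, ∏ i, f i (k z i) := by
        refine Finset.sum_congr rfl fun z hz => Finset.prod_congr rfl fun i _ => ?_
        have h : x i / δ - (k z i : ℝ) = (x i - z i) / δ := by
          rw [hk z hz i]
          field_simp
        simp only [hf, h, abs_div, abs_of_pos hδ]
    _ = ∑ m ∈ G.image k, ∏ i, f i (m i) := by rw [Finset.sum_image hinj]
    _ ≤ ∑ m ∈ Fintype.piFinset fun i => (G.image k).image fun m => m i, ∏ i, f i (m i) := by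
        refine Finset.sum_le_sum_of_subset_of_nonneg (fun m hm => ?_)
          fun m _ _ => Finset.prod_nonneg fun i _ => hf0 i (m i)
        exact Fintype.mem_piFinset.2 fun i => Finset.mem_image_of_mem (fun m => m i) hm
    _ = ∏ i, ∑ n ∈ (G.image k).image fun m => m i, f i n := by
        rw [Finset.prod_univ_sum]
    _ ≤ 1 := Finset.prod_le_one (fun i _ => Finset.sum_nonneg fun n _ => hf0 i n)
        fun i _ => sum_hat_int_le_one _ _

/-- The support of a hat function lies in a ball of radius `√d * δ` about its centre. -/
lemma norm_sub_le_of_hatFn_ne_zero {d : ℕ} {δ : ℝ} (hδ : 0 < δ)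
    {z x : EuclideanSpace ℝ (Fin d)} (h : hatFn δ z x ≠ 0) :
    ‖z - x‖ ≤ Real.sqrt d * δ := by
  have hi : ∀ i, |x i - z i| ≤ δ := by
    intro i
    by_contra! hlt
    refine h (Finset.prod_eq_zero (Finset.mem_univ i) (max_eq_left ?_))
    linarith [(one_lt_div hδ).2 hlt]
  rw [EuclideanSpace.norm_eq]
  calc Real.sqrt (∑ i, ‖(z - x) i‖ ^ 2) ≤ Real.sqrt (∑ _i : Fin d, δ ^ 2) := by
        refine Real.sqrt_le_sqrt (Finset.sum_le_sum fun i _ => ?_)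
        rw [PiLp.sub_apply, Real.norm_eq_abs, abs_sub_comm]
        gcongr
        exact hi i
    _ = Real.sqrt d * δ := by
        rw [Finset.sum_const, Finset.card_univ, Fintype.card_fin, nsmul_eq_mul,
          Real.sqrt_mul (Nat.cast_nonneg d), Real.sqrt_sq hδ.le]

/-- A nearest point of a convex set containing the origin is no longer than the original point. -/
lemma norm_le_of_dist_le_of_convex {E : Type*} [NormedAddCommGroup E] [InnerProductSpace ℝ E]
    {K : Set E} (hK : Convex ℝ K) (h0 : (0 : E) ∈ K) {x p : E} (hp : p ∈ K)
    (hmin : ∀ y ∈ K, dist x p ≤ dist x y) : ‖p‖ ≤ ‖x‖ := by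
  have : Nonempty K := ⟨⟨p, hp⟩⟩
  have hinf : ‖x - p‖ = ⨅ w : K, ‖x - w‖ := by
    refine le_antisymm (le_ciInf fun w => ?_)
      (ciInf_le ⟨0, Set.forall_mem_range.2 fun _ => norm_nonneg _⟩ (⟨p, hp⟩ : K))
    simpa only [dist_eq_norm] using hmin w w.2
  have h := (norm_eq_iInf_iff_real_inner_le_zero hK hp).1 hinf 0 h0
  rw [zero_sub, inner_neg_right, inner_sub_left, real_inner_self_eq_norm_sq] at h
  have hcs := real_inner_le_norm x p
  by_contra! hlt
  nlinarith [norm_nonneg x]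

/-- If `ρ : ℝ^d → [1,∞)` is nondecreasing in `|x|`, then
`sup_x Pρ(x)/ρ(x) ≤ sup { ρ(y)/ρ(x) : x,y ∈ □, |y−x| ≤ √d·δ }`, stated as: any upper
bound `B` of the right-hand family bounds `Pρ(x)/ρ(x)` for all `x`. -/
theorem stmt16 (d : ℕ) (hd : 0 < d) (δ : ℝ) (hδ : 0 < δ)
    (G : Finset (EuclideanSpace ℝ (Fin d))) (hGne : G.Nonempty)
    (hGgrid : ∀ z ∈ G, ∀ i, ∃ k : ℤ, z i = (k : ℝ) * δ)
    (h0 : (0 : EuclideanSpace ℝ (Fin d)) ∈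
      convexHull ℝ (G : Set (EuclideanSpace ℝ (Fin d))))
    (proj : EuclideanSpace ℝ (Fin d) → EuclideanSpace ℝ (Fin d))
    (hproj : ∀ x, proj x ∈ convexHull ℝ (G : Set (EuclideanSpace ℝ (Fin d))) ∧
      ∀ y ∈ convexHull ℝ (G : Set (EuclideanSpace ℝ (Fin d))), dist x (proj x) ≤ dist x y)
    (ρ : EuclideanSpace ℝ (Fin d) → ℝ) (hρ1 : ∀ x, 1 ≤ ρ x)
    (hρmono : ∀ x y : EuclideanSpace ℝ (Fin d), ‖x‖ ≤ ‖y‖ → ρ x ≤ ρ y) :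
    ∀ B : ℝ,
      (∀ x' ∈ convexHull ℝ (G : Set (EuclideanSpace ℝ (Fin d))),
        ∀ y' ∈ convexHull ℝ (G : Set (EuclideanSpace ℝ (Fin d))),
          ‖y' - x'‖ ≤ Real.sqrt d * δ → ρ y' / ρ x' ≤ B) →
      ∀ x, interp δ G proj ρ x / ρ x ≤ B := by
  intro B hB
  have hB1 : 1 ≤ B := by
    have h := hB 0 h0 0 h0 (by simpa using mul_nonneg (Real.sqrt_nonneg d) hδ.le)
    rwa [div_self (by linarith [hρ1 0])] at h
  have hpos : ∀ x, 0 < ρ x := fun x => one_pos.trans_le (hρ1 x)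
  have key : ∀ p ∈ convexHull ℝ (G : Set (EuclideanSpace ℝ (Fin d))),
      ∑ z ∈ G, hatFn δ z p • ρ z ≤ B * ρ p := by
    intro p hp
    calc ∑ z ∈ G, hatFn δ z p • ρ z ≤ ∑ z ∈ G, hatFn δ z p * (B * ρ p) := by
          refine Finset.sum_le_sum fun z hz => ?_
          rw [smul_eq_mul]
          by_cases h : hatFn δ z p = 0
          · simp [h]
          · exact mul_le_mul_of_nonneg_left ((div_le_iff₀ (hpos p)).1
              (hB p hp z (subset_convexHull ℝ _ hz) (norm_sub_le_of_hatFn_ne_zero hδ h)))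
              (hatFn_nonneg δ z p)
      _ = (∑ z ∈ G, hatFn δ z p) * (B * ρ p) := (Finset.sum_mul _ _ _).symm
      _ ≤ B * ρ p := mul_le_of_le_one_left
          (mul_nonneg (zero_le_one.trans hB1) (hpos p).le) (sum_hatFn_le_one hδ G hGgrid p)
  intro x
  rw [div_le_iff₀ (hpos x), interp]
  split_ifs with hx
  · exact key x hx
  · refine (key _ (hproj x).1).trans
      (mul_le_mul_of_nonneg_left (hρmono _ _ ?_) (zero_le_one.trans hB1))
    exact norm_le_of_dist_le_of_convex (convex_convexHull ℝ _) h0 (hproj x).1 (hproj x).2
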